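/- Let ε = e^{2πi/5}, u_5(x,y) = x^8 + x^7y + 7x^6y^2 − 7x^5y^3 + 7x^3y^5 + 7x^2y^6 − xy^7 + y^8, and for k = 1,…,5 set u_k(x,y) = u_5(ε^{3k}x, ε^{2k}y). Let H(x,y) = x^20 + 228x^15y^5 + 494x^10y^10 − 228x^5y^15 + y^20. Then the product u_1·u_2·u_3·u_4·u_5 equals H^2 in ℂ[x,y]. -/

import Mathlib

open MvPolynomial

noncomputable def ε : ℂ := Complex.exp (2 * Real.pi * Complex.I / 5)

noncomputable def u5 : MvPolynomial (Fin 2) ℂ :=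
  (X 0) ^ 8 + (X 0) ^ 7 * X 1 + 7 * (X 0) ^ 6 * (X 1) ^ 2 - 7 * (X 0) ^ 5 * (X 1) ^ 3
    + 7 * (X 0) ^ 3 * (X 1) ^ 5 + 7 * (X 0) ^ 2 * (X 1) ^ 6 - X 0 * (X 1) ^ 7 + (X 1) ^ 8

/-- `u k` is `u5(ε^(3k) x, ε^(2k) y)`. -/
noncomputable def u (k : ℕ) : MvPolynomial (Fin 2) ℂ :=
  aeval ![C (ε ^ (3 * k)) * X 0, C (ε ^ (2 * k)) * X 1] u5

noncomputable def H : MvPolynomial (Fin 2) ℂ :=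
  (X 0) ^ 20 + 228 * (X 0) ^ 15 * (X 1) ^ 5 + 494 * (X 0) ^ 10 * (X 1) ^ 10
    - 228 * (X 0) ^ 5 * (X 1) ^ 15 + (X 1) ^ 20

/-- The resolvent of a cubic at the fifth roots of unity, i.e. a circulant determinant. -/
lemma prod_cubic_fifth_roots {R : Type*} [CommRing R] {w : R}
    (hw : 1 + w + w ^ 2 + w ^ 3 + w ^ 4 = 0) (a b c d A B D : R)
    (hA : A = a ^ 2 + b ^ 2 + c ^ 2 + d ^ 2) (hB : B = a * b + b * c + c * d)
    (hD : D = a * c + b * d + a * d) :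
    (a + b * w + c * w ^ 2 + d * w ^ 3) * (a + b * w ^ 2 + c * w ^ 4 + d * w)
      * (a + b * w ^ 3 + c * w + d * w ^ 4) * (a + b * w ^ 4 + c * w ^ 3 + d * w ^ 2)
      = A ^ 2 - A * (B + D) - B ^ 2 - D ^ 2 + 3 * B * D := by
  have h5 : w ^ 5 = 1 := by linear_combination (w - 1) * hw
  have h14 : (a + b * w + c * w ^ 2 + d * w ^ 3) * (a + b * w ^ 4 + c * w ^ 3 + d * w ^ 2)
      = A + B * (w + w ^ 4) + D * (w ^ 2 + w ^ 3) := by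
    subst hA hB hD; grind
  have h23 : (a + b * w ^ 2 + c * w ^ 4 + d * w) * (a + b * w ^ 3 + c * w + d * w ^ 4)
      = A + B * (w ^ 2 + w ^ 3) + D * (w + w ^ 4) := by
    subst hA hB hD; grind
  have hprod : (A + B * (w + w ^ 4) + D * (w ^ 2 + w ^ 3))
      * (A + B * (w ^ 2 + w ^ 3) + D * (w + w ^ 4))
      = A ^ 2 - A * (B + D) - B ^ 2 - D ^ 2 + 3 * B * D := by
    clear hA hB hD h14 h23; grind
  rw [← hprod, ← h14, ← h23]
  ring

lemma ε_isPrimitiveRoot : IsPrimitiveRoot ε 5 := by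
  simpa [ε] using Complex.isPrimitiveRoot_exp 5 (by norm_num)

lemma u_eq (k : ℕ) : u k = C ε ^ k *
    ((X 1 ^ 8 - 7 * X 0 ^ 5 * X 1 ^ 3) + (7 * X 0 ^ 6 * X 1 ^ 2 - X 0 * X 1 ^ 7) * C ε ^ k
      + (X 0 ^ 7 * X 1 + 7 * X 0 ^ 2 * X 1 ^ 6) * (C ε ^ k) ^ 2
      + (X 0 ^ 8 + 7 * X 0 ^ 3 * X 1 ^ 5) * (C ε ^ k) ^ 3) := by
  have hz : ((C ε : MvPolynomial (Fin 2) ℂ) ^ k) ^ 5 = 1 := by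
    rw [← pow_mul, mul_comm, pow_mul, ← C_pow, ε_isPrimitiveRoot.pow_eq_one, C_1, one_pow]
  simp only [u, u5, map_add, map_sub, map_mul, map_pow, map_ofNat, aeval_X,
    Matrix.cons_val_zero, Matrix.cons_val_one, mul_comm _ k, pow_mul]
  generalize (C ε : MvPolynomial (Fin 2) ℂ) ^ k = z at hz ⊢
  grind

theorem prod_u_eq_H_sq : u 1 * u 2 * u 3 * u 4 * u 5 = H ^ 2 := by
  have hw : 1 + (C ε : MvPolynomial (Fin 2) ℂ) + C ε ^ 2 + C ε ^ 3 + C ε ^ 4 = 0 := by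
    have h := ε_isPrimitiveRoot.geom_sum_eq_zero (by norm_num)
    simp only [Finset.sum_range_succ, Finset.sum_range_zero, zero_add, pow_zero, pow_one] at h
    simpa using congrArg (C : ℂ → MvPolynomial (Fin 2) ℂ) h
  simp only [u_eq, H]
  generalize (C ε : MvPolynomial (Fin 2) ℂ) = w at hw ⊢
  generalize (X 0 : MvPolynomial (Fin 2) ℂ) = x
  generalize (X 1 : MvPolynomial (Fin 2) ℂ) = y
  have h5 : w ^ 5 = 1 := by linear_combination (w - 1) * hw
  have h6 : w ^ 6 = w := by linear_combination w * h5
  have h8 : w ^ 8 = w ^ 3 := by linear_combination w ^ 3 * h5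
  have h9 : w ^ 9 = w ^ 4 := by linear_combination w ^ 4 * h5
  have h12 : w ^ 12 = w ^ 2 := by linear_combination (w ^ 7 + w ^ 2) * h5
  have key := prod_cubic_fifth_roots hw (y ^ 8 - 7 * x ^ 5 * y ^ 3)
    (7 * x ^ 6 * y ^ 2 - x * y ^ 7) (x ^ 7 * y + 7 * x ^ 2 * y ^ 6)
    (x ^ 8 + 7 * x ^ 3 * y ^ 5) _ _ _ rfl rfl rfl
  simp only [← pow_mul, Nat.reduceMul, h5, h6, h8, h9, h12, pow_one, mul_one]
  set a := y ^ 8 - 7 * x ^ 5 * y ^ 3 with ha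
  set b := 7 * x ^ 6 * y ^ 2 - x * y ^ 7 with hb
  set c := x ^ 7 * y + 7 * x ^ 2 * y ^ 6 with hc
  set d := x ^ 8 + 7 * x ^ 3 * y ^ 5 with hd
  calc
    _ = w ^ 10 * ((a + b * w + c * w ^ 2 + d * w ^ 3) * (a + b * w ^ 2 + c * w ^ 4 + d * w)
      * (a + b * w ^ 3 + c * w + d * w ^ 4) * (a + b * w ^ 4 + c * w ^ 3 + d * w ^ 2))
      * (a + b + c + d) := by ring
    _ = _ := by
      rw [key, show w ^ 10 = 1 by linear_combination (w ^ 5 + 1) * h5, ha, hb, hc, hd]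
      ring
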